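/- arXiv:0705.1333 — 8 statements merged into one kernel-verified Lean document; each statement's English description precedes it below -/
import Mathlib

section
/- Let a ∈ (0,1). The map from (0,∞) × (−1,1) to ℝ² sending (ρ, v) to ( U₂(ρ,v), U₃(ρ,v) ) = ( (a²+1)ρ v/(1−v²), (a²+1)ρ v²/(1−v²) + ρ ) is injective. That is, if ρ₁, ρ₂ > 0 and v₁, v₂ ∈ (−1,1) satisfy U₂(ρ₁,v₁) = U₂(ρ₂,v₂) and U₃(ρ₁,v₁) = U₃(ρ₂,v₂), then ρ₁ = ρ₂ and v₁ = v₂. -/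
/-- The map `(ρ, v) ↦ (U₂, U₃) = ((a²+1)ρv/(1−v²), (a²+1)ρv²/(1−v²) + ρ)` is
injective on `(0,∞) × (−1,1)`. -/
theorem momentum_energy_map_injective
    (a : ℝ) (ha0 : 0 < a) (ha1 : a < 1) :
    ∀ ρ₁ v₁ ρ₂ v₂ : ℝ,
      0 < ρ₁ → -1 < v₁ → v₁ < 1 → 0 < ρ₂ → -1 < v₂ → v₂ < 1 →
      (a ^ 2 + 1) * ρ₁ * v₁ / (1 - v₁ ^ 2) = (a ^ 2 + 1) * ρ₂ * v₂ / (1 - v₂ ^ 2) →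
      (a ^ 2 + 1) * ρ₁ * v₁ ^ 2 / (1 - v₁ ^ 2) + ρ₁
        = (a ^ 2 + 1) * ρ₂ * v₂ ^ 2 / (1 - v₂ ^ 2) + ρ₂ →
      ρ₁ = ρ₂ ∧ v₁ = v₂ := by
  intro ρ₁ v₁ ρ₂ v₂ hρ₁ hl₁ hu₁ hρ₂ hl₂ hu₂ hU₂ hU₃
  have hd₁ : 0 < 1 - v₁ ^ 2 := by nlinarith
  have hd₂ : 0 < 1 - v₂ ^ 2 := by nlinarith
  obtain ⟨r₁, hr₁⟩ : ∃ r, r = ρ₁ / (1 - v₁ ^ 2) := ⟨_, rfl⟩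
  obtain ⟨r₂, hr₂⟩ : ∃ r, r = ρ₂ / (1 - v₂ ^ 2) := ⟨_, rfl⟩
  have hr₁_pos : 0 < r₁ := hr₁ ▸ div_pos hρ₁ hd₁
  have hr₂_pos : 0 < r₂ := hr₂ ▸ div_pos hρ₂ hd₂
  obtain rfl : ρ₁ = r₁ * (1 - v₁ ^ 2) := by rw [hr₁, div_mul_cancel₀ _ hd₁.ne']
  obtain rfl : ρ₂ = r₂ * (1 - v₂ ^ 2) := by rw [hr₂, div_mul_cancel₀ _ hd₂.ne']
  have hmom : r₁ * v₁ = r₂ * v₂ := by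
    field_simp at hU₂
    linarith
  have hen : r₁ * (1 + a ^ 2 * v₁ ^ 2) = r₂ * (1 + a ^ 2 * v₂ ^ 2) := by
    field_simp at hU₃
    linarith
  have hcross : (r₁ * r₂ * (1 - a ^ 2 * (v₁ * v₂))) * (v₁ - v₂) = 0 := by
    linear_combination r₂ * (1 + a ^ 2 * v₂ ^ 2) * hmom - r₂ * v₂ * hen
  have hv_prod : v₁ * v₂ < 1 := by nlinarith [sq_nonneg (v₁ - v₂)]
  have ha_sq : a ^ 2 < 1 := by nlinarith
  have hfactor : 0 < 1 - a ^ 2 * (v₁ * v₂) := by nlinarith [sq_nonneg a]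
  obtain rfl : v₁ = v₂ := sub_eq_zero.mp <|
    (mul_eq_zero.mp hcross).resolve_left (by positivity)
  obtain rfl : r₁ = r₂ := mul_right_cancel₀ (by positivity) hen
  exact ⟨rfl, rfl⟩
end

section
/- Let a ∈ (0,1), let γ = a² + 1 (so 1 < γ < 2), and let A : (0,∞) → (0,∞) be continuously differentiable with A′(S) > 0 for all S > 0. Define n(ρ,S) = (ρ/A(S))^(1/γ) and the map from { (ρ,v,S) : ρ > 0, −1 < v < 1, S > 0 } to ℝ³ sending (ρ,v,S) to ( U₁, U₂, U₃ ) = ( n(ρ,S)/√(1−v²), (a²+1)ρ v/(1−v²), (a²+1)ρ v²/(1−v²) + ρ ). Then this map is injective. -/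
/-- The momentum and energy components alone determine the density and the velocity. -/
theorem density_velocity_eq_of_momentum_energy_eq {b ρ₁ v₁ ρ₂ v₂ : ℝ}
    (hb0 : 0 < b) (hb1 : b < 1) (hρ₁ : 0 < ρ₁) (hv₁ : -1 < v₁) (hv₁' : v₁ < 1)
    (hρ₂ : 0 < ρ₂) (hv₂ : -1 < v₂) (hv₂' : v₂ < 1)
    (hmom : (b + 1) * ρ₁ * v₁ / (1 - v₁ ^ 2) = (b + 1) * ρ₂ * v₂ / (1 - v₂ ^ 2))
    (hen : (b + 1) * ρ₁ * v₁ ^ 2 / (1 - v₁ ^ 2) + ρ₁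
      = (b + 1) * ρ₂ * v₂ ^ 2 / (1 - v₂ ^ 2) + ρ₂) :
    ρ₁ = ρ₂ ∧ v₁ = v₂ := by
  have hw₁ : 0 < 1 - v₁ ^ 2 := by nlinarith
  have hw₂ : 0 < 1 - v₂ ^ 2 := by nlinarith
  obtain ⟨r₁, hr₁⟩ : ∃ r, r = ρ₁ / (1 - v₁ ^ 2) := ⟨_, rfl⟩
  obtain ⟨r₂, hr₂⟩ : ∃ r, r = ρ₂ / (1 - v₂ ^ 2) := ⟨_, rfl⟩
  have hr₁pos : 0 < r₁ := hr₁ ▸ div_pos hρ₁ hw₁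
  have hr₂pos : 0 < r₂ := hr₂ ▸ div_pos hρ₂ hw₂
  obtain rfl : ρ₁ = r₁ * (1 - v₁ ^ 2) := by rw [hr₁, div_mul_cancel₀ _ hw₁.ne']
  obtain rfl : ρ₂ = r₂ * (1 - v₂ ^ 2) := by rw [hr₂, div_mul_cancel₀ _ hw₂.ne']
  have hmom' : r₁ * v₁ = r₂ * v₂ := by
    field_simp at hmom
    linarith
  have hen' : r₁ * (1 + b * v₁ ^ 2) = r₂ * (1 + b * v₂ ^ 2) := by
    field_simp at hen
    linarith
  have hvv : v₁ * v₂ < 1 := by nlinarith [sq_nonneg (v₁ - v₂)]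
  have hne : 1 - b * (v₁ * v₂) ≠ 0 := by nlinarith
  have hprod : r₁ * r₂ * (1 - b * (v₁ * v₂)) * (v₁ - v₂) = 0 := by
    linear_combination r₁ * v₁ * (-hen') + r₁ * (1 + b * v₁ ^ 2) * hmom'
  have hv : v₁ = v₂ := by
    simpa [hr₁pos.ne', hr₂pos.ne', hne, sub_eq_zero] using hprod
  subst hv
  have hr : r₁ = r₂ := mul_right_cancel₀ (by positivity) hen'
  exact ⟨by rw [hr], rfl⟩

/-- For the ultra-relativistic Euler equations with equation of state
`ε(n,S) = A(S)n^(γ−1)`, `γ = a²+1`, the map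
`(ρ, v, S) ↦ (U₁, U₂, U₃) = (n(ρ,S)/√(1−v²), (a²+1)ρv/(1−v²), (a²+1)ρv²/(1−v²)+ρ)`
with `n(ρ,S) = (ρ/A(S))^(1/γ)` is injective on `{ρ > 0, −1 < v < 1, S > 0}`. -/
theorem conserved_variables_map_injective
    (a γ : ℝ) (ha0 : 0 < a) (ha1 : a < 1) (hγ : γ = a ^ 2 + 1)
    (A : ℝ → ℝ)
    (hApos : ∀ S : ℝ, 0 < S → 0 < A S)
    (hAC1 : ContDiffOn ℝ 1 A (Set.Ioi 0))
    (hA' : ∀ S : ℝ, 0 < S → 0 < deriv A S)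
    (n : ℝ → ℝ → ℝ)
    (hn : ∀ ρ S : ℝ, n ρ S = (ρ / A S) ^ (1 / γ)) :
    ∀ ρ₁ v₁ S₁ ρ₂ v₂ S₂ : ℝ,
      0 < ρ₁ → -1 < v₁ → v₁ < 1 → 0 < S₁ →
      0 < ρ₂ → -1 < v₂ → v₂ < 1 → 0 < S₂ →
      n ρ₁ S₁ / Real.sqrt (1 - v₁ ^ 2) = n ρ₂ S₂ / Real.sqrt (1 - v₂ ^ 2) →
      (a ^ 2 + 1) * ρ₁ * v₁ / (1 - v₁ ^ 2) = (a ^ 2 + 1) * ρ₂ * v₂ / (1 - v₂ ^ 2) →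
      (a ^ 2 + 1) * ρ₁ * v₁ ^ 2 / (1 - v₁ ^ 2) + ρ₁
        = (a ^ 2 + 1) * ρ₂ * v₂ ^ 2 / (1 - v₂ ^ 2) + ρ₂ →
      ρ₁ = ρ₂ ∧ v₁ = v₂ ∧ S₁ = S₂ := by
  intro ρ₁ v₁ S₁ ρ₂ v₂ S₂ hρ₁ hv₁ hv₁' hS₁ hρ₂ hv₂ hv₂' hS₂ hnum hmom hen
  obtain ⟨rfl, rfl⟩ := density_velocity_eq_of_momentum_energy_eq (pow_pos ha0 2)
    (pow_lt_one₀ ha0.le ha1 two_ne_zero) hρ₁ hv₁ hv₁' hρ₂ hv₂ hv₂' hmom hen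
  refine ⟨rfl, rfl, ?_⟩
  have hw : 0 < 1 - v₁ ^ 2 := by nlinarith
  have hA₁ := hApos S₁ hS₁
  have hA₂ := hApos S₂ hS₂
  have hγ0 : 1 / γ ≠ 0 := by
    rw [hγ]
    positivity
  rw [div_left_inj' (Real.sqrt_pos.2 hw).ne', hn, hn,
    Real.rpow_left_inj (by positivity) (by positivity) hγ0,
    div_eq_mul_inv, div_eq_mul_inv, mul_right_inj' hρ₁.ne', inv_inj] at hnum
  have hmono : StrictMonoOn A (Set.Ioi 0) :=
    strictMonoOn_of_deriv_pos (convex_Ioi 0) hAC1.continuousOn fun S hS ↦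
      hA' S (interior_subset hS)
  exact hmono.injOn hS₁ hS₂ hnum
end

section
/- Let a ∈ (0,1), v ∈ (−1,1), and let ρ, n, T, ε > 0 be real numbers. Let J be the 3×3 real matrix J = [[ 1/((a²+1)√(1−v²) ε), (a²+1)v/(1−v²), (a²+1)v²/(1−v²) + 1 ], [ n v/(1−v²)^{3/2}, (a²+1)ρ(1+v²)/(1−v²)², (a²+1)·2ρv/(1−v²)² ], [ −n²T/((1+a²)ρ), 0, 0 ]]. Then det(J) = n²T(1−a²v²)/(1−v²)², and in particular det(J) > 0. -/
/-- The Jacobian determinant of the change of variables `(ρ,v,S) ↦ (U₁,U₂,U₃)` for the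
ultra-relativistic Euler equations with `p = a²ρ` equals `n²T(1−a²v²)/(1−v²)²`, which
is positive. -/
theorem jacobian_determinant_positive
    (a v ρ n T ε : ℝ) (ha0 : 0 < a) (ha1 : a < 1) (hv0 : -1 < v) (hv1 : v < 1)
    (hρ : 0 < ρ) (hn : 0 < n) (hT : 0 < T) (hε : 0 < ε)
    (J : Matrix (Fin 3) (Fin 3) ℝ)
    (hJ : J = !![1 / ((a ^ 2 + 1) * Real.sqrt (1 - v ^ 2) * ε),
                 (a ^ 2 + 1) * v / (1 - v ^ 2),
                 (a ^ 2 + 1) * v ^ 2 / (1 - v ^ 2) + 1;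
                 n * v / (1 - v ^ 2) ^ ((3 : ℝ) / 2),
                 (a ^ 2 + 1) * ρ * (1 + v ^ 2) / (1 - v ^ 2) ^ 2,
                 (a ^ 2 + 1) * 2 * ρ * v / (1 - v ^ 2) ^ 2;
                 -(n ^ 2 * T) / ((1 + a ^ 2) * ρ), 0, 0]) :
    J.det = n ^ 2 * T * (1 - a ^ 2 * v ^ 2) / (1 - v ^ 2) ^ 2 ∧ 0 < J.det := by
  have hw : 0 < 1 - v ^ 2 := by nlinarith
  have hav : 0 < 1 - a ^ 2 * v ^ 2 := by nlinarith [sq_nonneg v, mul_pos ha0 ha0]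
  have hdet : J.det = n ^ 2 * T * (1 - a ^ 2 * v ^ 2) / (1 - v ^ 2) ^ 2 := by
    have hw' : 1 - v ^ 2 ≠ 0 := hw.ne'
    have ha' : 1 + a ^ 2 ≠ 0 := by positivity
    rw [hJ, Matrix.det_fin_three]
    simp only [Matrix.of_apply, Matrix.cons_val, mul_zero, sub_zero,
      add_zero, zero_add]
    field_simp
    ring
  refine ⟨hdet, ?_⟩
  rw [hdet]
  positivity
end

section
/- (Taub, 1948.) Let s ∈ ℝ and let (ρ, v, n, p) and (ρ_L, v_L, n_L, p_L) be two states with n, n_L > 0, p + ρ > 0, p_L + ρ_L > 0 and v, v_L ∈ (−1,1). Write u = (1/√(1−v²), v/√(1−v²)), u_L = (1/√(1−v_L²), v_L/√(1−v_L²)), and l_α-contraction X·l = −X⁰ + sX¹ for a 2-vector X = (X⁰, X¹). Suppose the Rankine–Hugoniot jump conditions hold across a shock of speed s: m := n(u·l) = n_L(u_L·l) with m ≠ 0, and for β = 0,1: n g u^β (u·l) + p l^β_∗ = n_L g_L u_L^β (u_L·l) + p_L l^β_∗, where g = (p+ρ)/n, g_L = (p_L+ρ_L)/n_L and (l⁰_∗,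 l¹_∗) = (−1·η-raised: l⁰_∗ = −(−1) and l¹_∗ = s, i.e. l_∗ = (l_0·η⁰⁰, l_1·η¹¹) = (1, s)·η-contraction) — explicitly, the two equations are m g u⁰ + p·(1) = m g_L u_L⁰ + p_L·(1) after contracting with η, in covariant form [[T^{αβ}]]l_α = 0 for the stress tensor T^{αβ} = (ρ+p)u^α u^β + p η^{αβ} with η = diag(−1,1). Then the Taub adiabat relation holds: ((ρ+p)/n²)·(ρ + p_L) = ((ρ_L+p_L)/n_L²)·(ρ_L + p). -/
/-- The velocity `(1, v) / √(1 - v²)` of a subluminal particle has unit Minkowski norm. -/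
theorem sq_sub_sq_lorentz_velocity {v : ℝ} (h0 : -1 < v) (h1 : v < 1) :
    (1 / Real.sqrt (1 - v ^ 2)) ^ 2 - (v / Real.sqrt (1 - v ^ 2)) ^ 2 = 1 := by
  have h : 0 < 1 - v ^ 2 := by nlinarith
  rw [div_pow, div_pow, Real.sq_sqrt h.le]
  field_simp

/-- Contracting the jump `w k (a, b) - w' k' (c, d) = (p' - p) (1, s)` with the sum of the two
momentum fluxes `w k (a, b)` and `w' k' (c, d)`. -/
theorem enthalpy_flux_relation {a b c d s w w' p p' k k' : ℝ}
    (hab : a ^ 2 - b ^ 2 = 1) (hcd : c ^ 2 - d ^ 2 = 1)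
    (hk : k = -a + s * b) (hk' : k' = -c + s * d)
    (h0 : w * k * a + p = w' * k' * c + p')
    (h1 : w * k * b + s * p = w' * k' * d + s * p') :
    w * k ^ 2 * (w - p + p') = w' * k' ^ 2 * (w' + p - p') := by
  linear_combination (w * k * a + w' * k' * c) * h0 - (w * k * b + w' * k' * d) * h1
    - (w * k) ^ 2 * hab + (w' * k') ^ 2 * hcd
    - (p - p') * w * k * hk - (p - p') * w' * k' * hk'

/-- Taub's relation (1948): across a shock of speed `s` (with worldline conormal
`l_α = (−1, s)`), the Rankine–Hugoniot jump conditions `[[n u^α]] l_α = 0` (with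
nonzero mass flux `m`) and `[[T^{αβ}]] l_α = 0` for the perfect-fluid stress tensor
`T^{αβ} = (ρ+p)u^α u^β + p η^{αβ}`, `η = diag(−1,1)`, imply the Taub adiabat
`((ρ+p)/n²)(ρ+p_L) = ((ρ_L+p_L)/n_L²)(ρ_L+p)`. -/
theorem taub_adiabat
    (s ρ v n p ρL vL nL pL : ℝ)
    (hn : 0 < n) (hnL : 0 < nL)
    (hpρ : 0 < p + ρ) (hpρL : 0 < pL + ρL)
    (hv0 : -1 < v) (hv1 : v < 1) (hvL0 : -1 < vL) (hvL1 : vL < 1)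
    (u uL : Fin 2 → ℝ)
    (hu : u = ![1 / Real.sqrt (1 - v ^ 2), v / Real.sqrt (1 - v ^ 2)])
    (huL : uL = ![1 / Real.sqrt (1 - vL ^ 2), vL / Real.sqrt (1 - vL ^ 2)])
    (η : Matrix (Fin 2) (Fin 2) ℝ) (hη : η = !![-1, 0; 0, 1])
    (m : ℝ)
    (hm : m = n * (-(u 0) + s * u 1))
    (hmL : m = nL * (-(uL 0) + s * uL 1))
    (hm0 : m ≠ 0)
    (hjump : ∀ β : Fin 2,
      -((ρ + p) * u 0 * u β + p * η 0 β) + s * ((ρ + p) * u 1 * u β + p * η 1 β)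
        = -((ρL + pL) * uL 0 * uL β + pL * η 0 β)
            + s * ((ρL + pL) * uL 1 * uL β + pL * η 1 β)) :
    (ρ + p) / n ^ 2 * (ρ + pL) = (ρL + pL) / nL ^ 2 * (ρL + p) := by
  have hab : u 0 ^ 2 - u 1 ^ 2 = 1 := by
    simpa [hu] using sq_sub_sq_lorentz_velocity hv0 hv1
  have hcd : uL 0 ^ 2 - uL 1 ^ 2 = 1 := by
    simpa [huL] using sq_sub_sq_lorentz_velocity hvL0 hvL1
  have hk : m / n = -(u 0) + s * u 1 := by rw [hm]; field_simp
  have hkL : m / nL = -(uL 0) + s * uL 1 := by rw [hmL]; field_simp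
  have h0 := hjump 0
  have h1 := hjump 1
  simp [hη] at h0 h1
  have key := enthalpy_flux_relation (w := ρ + p) (w' := ρL + pL) (p := p) (p' := pL)
    hab hcd hk hkL
    (by rw [hk, hkL]; linear_combination h0) (by rw [hk, hkL]; linear_combination h1)
  apply mul_left_cancel₀ (pow_ne_zero 2 hm0)
  linear_combination key
end

section
/- Let 1 < γ < 2 and set a² = γ − 1. Let ρ, ρ_L, n, n_L > 0 satisfy n²/n_L² = (ρ²/ρ_L²)·(1 + (γ−1)ρ_L/ρ)/(1 + (γ−1)ρ/ρ_L), and set σ = ln(ρ/ρ_L), Σ = ln(ρ/n^γ), Σ_L = ln(ρ_L/n_L^γ). Then Σ − Σ_L = (1−γ)σ + (γ/2)·ln( (1 + (γ−1)e^σ) / (1 + (γ−1)e^{−σ}) ). In particular, Σ − Σ_L depends only on σ = ln(ρ/ρ_L) and not otherwise on the base state (ρ_L, n_L). -/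
/-- Across a shock of the ultra-relativistic Euler equations with `p = (γ−1)ρ`, the
change of `Σ = ln(ρ/n^γ) = ln(A(S))` depends only on `σ = ln(ρ/ρ_L)`:
`Σ − Σ_L = (1−γ)σ + (γ/2)·ln((1+(γ−1)e^σ)/(1+(γ−1)e^{−σ}))`. -/
theorem entropy_jump_depends_only_on_strength
    (γ a : ℝ) (hγ1 : 1 < γ) (hγ2 : γ < 2) (ha : a ^ 2 = γ - 1)
    (ρ ρL n nL : ℝ) (hρ : 0 < ρ) (hρL : 0 < ρL) (hn : 0 < n) (hnL : 0 < nL)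
    (htaub : n ^ 2 / nL ^ 2
      = (ρ ^ 2 / ρL ^ 2) * (1 + (γ - 1) * ρL / ρ) / (1 + (γ - 1) * ρ / ρL))
    (σ Sig SigL : ℝ)
    (hσ : σ = Real.log (ρ / ρL))
    (hSig : Sig = Real.log (ρ / n ^ γ))
    (hSigL : SigL = Real.log (ρL / nL ^ γ)) :
    Sig - SigL = (1 - γ) * σ
      + (γ / 2) * Real.log ((1 + (γ - 1) * Real.exp σ) / (1 + (γ - 1) * Real.exp (-σ))) := by
  have hγ : 0 < γ - 1 := by linarith
  have hexp : Real.exp σ = ρ / ρL := by rw [hσ, Real.exp_log (by positivity)]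
  have hexp' : Real.exp (-σ) = ρL / ρ := by rw [Real.exp_neg, hexp, inv_div]
  have hA : 0 < 1 + (γ - 1) * (ρL / ρ) := by positivity
  have hB : 0 < 1 + (γ - 1) * (ρ / ρL) := by positivity
  have hlog := congrArg Real.log htaub
  rw [mul_div_assoc (γ - 1) ρL ρ, mul_div_assoc (γ - 1) ρ ρL,
    Real.log_div (by positivity) hB.ne', Real.log_mul (by positivity) hA.ne',
    Real.log_div (by positivity) (by positivity), Real.log_div (by positivity) (by positivity),
    Real.log_pow, Real.log_pow, Real.log_pow, Real.log_pow] at hlog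
  push_cast at hlog
  rw [hexp, hexp', hSig, hSigL, hσ, Real.log_div hB.ne' hA.ne',
    Real.log_div hρ.ne' hρL.ne', Real.log_div hρ.ne' (by positivity),
    Real.log_div hρL.ne' (by positivity), Real.log_rpow hn, Real.log_rpow hnL]
  linear_combination (-γ / 2) * hlog
end

section
/- Let 1 < γ < 2 and define f : ℝ → ℝ by f(σ) = (1−γ)σ + (γ/2)·ln( (1 + (γ−1)e^σ) / (1 + (γ−1)e^{−σ}) ). Then f is differentiable with f′(σ) = (e^σ − 1)²(2−γ)(γ−1) / ( 2(1 + e^σ(γ−1))(e^σ + (γ−1)) ) for every σ ∈ ℝ. Consequently f′(σ) ≥ 0 for all σ with f′(σ) = 0 if and only if σ = 0, and f is strictly monotone increasing on [0, ∞). -/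
/-- The entropy-jump function
`f(σ) = (1−γ)σ + (γ/2)ln((1+(γ−1)e^σ)/(1+(γ−1)e^{−σ}))` is differentiable with
`f′(σ) = (e^σ−1)²(2−γ)(γ−1)/(2(1+e^σ(γ−1))(e^σ+(γ−1)))`; consequently `f′ ≥ 0`,
`f′(σ) = 0 ↔ σ = 0`, and `f` is strictly monotone increasing on `[0,∞)`. -/
theorem entropy_jump_monotone
    (γ : ℝ) (hγ1 : 1 < γ) (hγ2 : γ < 2)
    (f : ℝ → ℝ)
    (hf : f = fun σ => (1 - γ) * σ
      + (γ / 2) * Real.log ((1 + (γ - 1) * Real.exp σ) / (1 + (γ - 1) * Real.exp (-σ)))) :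
    (∀ σ : ℝ, HasDerivAt f
      ((Real.exp σ - 1) ^ 2 * (2 - γ) * (γ - 1)
        / (2 * (1 + Real.exp σ * (γ - 1)) * (Real.exp σ + (γ - 1)))) σ)
    ∧ (∀ σ : ℝ, 0 ≤ (Real.exp σ - 1) ^ 2 * (2 - γ) * (γ - 1)
        / (2 * (1 + Real.exp σ * (γ - 1)) * (Real.exp σ + (γ - 1))))
    ∧ (∀ σ : ℝ, (Real.exp σ - 1) ^ 2 * (2 - γ) * (γ - 1)
        / (2 * (1 + Real.exp σ * (γ - 1)) * (Real.exp σ + (γ - 1))) = 0 ↔ σ = 0)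
    ∧ StrictMonoOn f (Set.Ici 0) := by
  have ha : 0 < γ - 1 := by linarith
  have hb : 0 < 2 - γ := by linarith
  have hden (σ : ℝ) : 0 < 2 * (1 + Real.exp σ * (γ - 1)) * (Real.exp σ + (γ - 1)) := by
    positivity
  have hderiv (σ : ℝ) : HasDerivAt f
      ((Real.exp σ - 1) ^ 2 * (2 - γ) * (γ - 1)
        / (2 * (1 + Real.exp σ * (γ - 1)) * (Real.exp σ + (γ - 1)))) σ := by
    have hE : 0 < Real.exp σ := Real.exp_pos σ
    have hnum : 0 < 1 + (γ - 1) * Real.exp σ := by positivity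
    have hdenom : 0 < 1 + (γ - 1) * Real.exp (-σ) := by positivity
    have h1 : HasDerivAt (fun x : ℝ => 1 + (γ - 1) * Real.exp x) ((γ - 1) * Real.exp σ) σ :=
      ((Real.hasDerivAt_exp σ).const_mul (γ - 1)).const_add 1
    have h2 : HasDerivAt (fun x : ℝ => 1 + (γ - 1) * Real.exp (-x))
        ((γ - 1) * (Real.exp (-σ) * -1)) σ :=
      (((hasDerivAt_neg σ).exp).const_mul (γ - 1)).const_add 1
    have h3 := ((hasDerivAt_id' σ).const_mul (1 - γ)).add
      (((h1.div h2 hdenom.ne').log (div_pos hnum hdenom).ne').const_mul (γ / 2))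
    rw [hf]
    refine h3.congr_deriv ?_
    simp only [Pi.div_apply]
    rw [Real.exp_neg] at hdenom ⊢
    generalize Real.exp σ = E at *
    have h4 : 0 < E + (γ - 1) := by positivity
    have h5 : 0 < 1 + E * (γ - 1) := by positivity
    have h6 : 1 + (γ - 1) * E⁻¹ = (E + (γ - 1)) / E := by field_simp
    rw [h6, mul_comm (γ - 1) E]
    field_simp
    ring
  have hzero (σ : ℝ) : (Real.exp σ - 1) ^ 2 * (2 - γ) * (γ - 1)
      / (2 * (1 + Real.exp σ * (γ - 1)) * (Real.exp σ + (γ - 1))) = 0 ↔ σ = 0 := by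
    rw [div_eq_zero_iff, or_iff_left (hden σ).ne', mul_eq_zero, or_iff_left ha.ne', mul_eq_zero,
      or_iff_left hb.ne', sq_eq_zero_iff, sub_eq_zero, Real.exp_eq_one_iff]
  have hnonneg (σ : ℝ) : 0 ≤ (Real.exp σ - 1) ^ 2 * (2 - γ) * (γ - 1)
      / (2 * (1 + Real.exp σ * (γ - 1)) * (Real.exp σ + (γ - 1))) := by
    positivity
  refine ⟨hderiv, hnonneg, hzero, ?_⟩
  refine strictMonoOn_of_deriv_pos (convex_Ici 0)
    (fun σ _ => (hderiv σ).continuousAt.continuousWithinAt) fun σ hσ => ?_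
  rw [interior_Ici, Set.mem_Ioi] at hσ
  rw [(hderiv σ).deriv]
  exact (hnonneg σ).lt_of_ne' fun h => hσ.ne' ((hzero σ).mp h)
end

section
/- Let 1 < γ < 2 and define f : ℝ → ℝ by f(σ) = (1−γ)σ + (γ/2)·ln( (1 + (γ−1)e^σ) / (1 + (γ−1)e^{−σ}) ). Then f is twice differentiable with f″(σ) = γ²(2−γ)(γ−1)(e^{3σ} − e^{σ}) / ( 2(1 + e^σ(γ−1))²(e^σ + (γ−1))² ) for every σ ∈ ℝ. Consequently f″(σ) ≥ 0 for σ ≥ 0, so the derivative f′ is monotone increasing on [0, ∞) and f is convex on [0, ∞). -/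
theorem hasDerivAt_log_one_add_exp_div {a : ℝ} (ha : 0 < a) (σ : ℝ) :
    HasDerivAt (fun σ => Real.log ((1 + a * Real.exp σ) / (1 + a * Real.exp (-σ))))
      (a * Real.exp σ / (1 + a * Real.exp σ) + a / (Real.exp σ + a)) σ := by
  have hN : HasDerivAt (fun σ => 1 + a * Real.exp σ) (a * Real.exp σ) σ :=
    ((Real.hasDerivAt_exp σ).const_mul a).const_add 1
  have hD : HasDerivAt (fun σ => 1 + a * Real.exp (-σ)) (a * (Real.exp (-σ) * -1)) σ :=
    ((hasDerivAt_neg σ).exp.const_mul a).const_add 1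
  have hD0 : 1 + a * Real.exp (-σ) ≠ 0 := by positivity
  refine ((hN.fun_div hD hD0).log (by positivity)).congr_deriv ?_
  rw [Real.exp_neg]
  field_simp
  ring

theorem hasDerivAt_exp_div_add_div {a : ℝ} (ha : 0 < a) (σ : ℝ) :
    HasDerivAt (fun σ => a * Real.exp σ / (1 + a * Real.exp σ) + a / (Real.exp σ + a))
      (a * (1 - a ^ 2) * (Real.exp (3 * σ) - Real.exp σ)
        / ((1 + Real.exp σ * a) ^ 2 * (Real.exp σ + a) ^ 2)) σ := by
  have hM : HasDerivAt (fun σ => a * Real.exp σ) (a * Real.exp σ) σ :=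
    (Real.hasDerivAt_exp σ).const_mul a
  have hN : 1 + a * Real.exp σ ≠ 0 := by positivity
  have hD : Real.exp σ + a ≠ 0 := by positivity
  have h3 : Real.exp (3 * σ) = Real.exp σ ^ 3 := by
    rw [← Real.exp_nat_mul]; norm_num
  refine ((hM.fun_div (hM.const_add 1) hN).fun_add
    ((hasDerivAt_const σ a).fun_div ((Real.hasDerivAt_exp σ).add_const a) hD)).congr_deriv ?_
  rw [h3, mul_comm (Real.exp σ) a]
  field_simp
  ring


/-- The entropy-jump function `f` is twice differentiable with
`f″(σ) = γ²(2−γ)(γ−1)(e^{3σ}−e^σ)/(2(1+e^σ(γ−1))²(e^σ+(γ−1))²)`; consequently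
`f″ ≥ 0` on `[0,∞)`, `f′` is monotone increasing on `[0,∞)` and `f` is convex
on `[0,∞)`. -/
theorem entropy_jump_convex
    (γ : ℝ) (hγ1 : 1 < γ) (hγ2 : γ < 2)
    (f : ℝ → ℝ)
    (hf : f = fun σ => (1 - γ) * σ
      + (γ / 2) * Real.log ((1 + (γ - 1) * Real.exp σ) / (1 + (γ - 1) * Real.exp (-σ)))) :
    ContDiff ℝ 2 f
    ∧ (∀ σ : ℝ, deriv (deriv f) σ
        = γ ^ 2 * (2 - γ) * (γ - 1) * (Real.exp (3 * σ) - Real.exp σ)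
          / (2 * (1 + Real.exp σ * (γ - 1)) ^ 2 * (Real.exp σ + (γ - 1)) ^ 2))
    ∧ (∀ σ : ℝ, 0 ≤ σ →
        0 ≤ γ ^ 2 * (2 - γ) * (γ - 1) * (Real.exp (3 * σ) - Real.exp σ)
          / (2 * (1 + Real.exp σ * (γ - 1)) ^ 2 * (Real.exp σ + (γ - 1)) ^ 2))
    ∧ MonotoneOn (deriv f) (Set.Ici 0)
    ∧ ConvexOn ℝ (Set.Ici 0) f := by
  have ha : 0 < γ - 1 := by linarith
  have h1 : ∀ σ, HasDerivAt f ((1 - γ) + (γ / 2) * ((γ - 1) * Real.exp σ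
      / (1 + (γ - 1) * Real.exp σ) + (γ - 1) / (Real.exp σ + (γ - 1)))) σ := by
    intro σ
    rw [hf]
    simpa using ((hasDerivAt_id σ).const_mul (1 - γ)).fun_add
      ((hasDerivAt_log_one_add_exp_div ha σ).const_mul (γ / 2))
  have h2 : ∀ σ, HasDerivAt (deriv f)
      (γ ^ 2 * (2 - γ) * (γ - 1) * (Real.exp (3 * σ) - Real.exp σ)
        / (2 * (1 + Real.exp σ * (γ - 1)) ^ 2 * (Real.exp σ + (γ - 1)) ^ 2)) σ := by
    intro σ
    rw [funext fun σ => (h1 σ).deriv]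
    refine (((hasDerivAt_exp_div_add_div ha σ).const_mul (γ / 2)).const_add
      (1 - γ)).congr_deriv ?_
    field_simp
    ring
  have hnn : ∀ σ : ℝ, 0 ≤ σ →
      0 ≤ γ ^ 2 * (2 - γ) * (γ - 1) * (Real.exp (3 * σ) - Real.exp σ)
        / (2 * (1 + Real.exp σ * (γ - 1)) ^ 2 * (Real.exp σ + (γ - 1)) ^ 2) := by
    intro σ hσ
    have h2γ : 0 ≤ 2 - γ := by linarith
    have hexp : 0 ≤ Real.exp (3 * σ) - Real.exp σ :=
      sub_nonneg.2 (Real.exp_le_exp.2 (by linarith))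
    positivity
  have hmono : MonotoneOn (deriv f) (Set.Ici 0) := by
    refine monotoneOn_of_deriv_nonneg (convex_Ici 0)
      (fun σ _ => (h2 σ).continuousAt.continuousWithinAt)
      (fun σ _ => (h2 σ).differentiableAt.differentiableWithinAt) fun σ hσ => ?_
    rw [(h2 σ).deriv]
    exact hnn σ (interior_subset hσ)
  refine ⟨?_, fun σ => (h2 σ).deriv, hnn, hmono, ?_⟩
  · rw [hf]
    have hN : ∀ σ, 1 + (γ - 1) * Real.exp σ ≠ 0 := fun σ => by positivity
    have hD : ∀ σ, 1 + (γ - 1) * Real.exp (-σ) ≠ 0 := fun σ => by positivity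
    refine (contDiff_const.mul contDiff_id).add (contDiff_const.mul (ContDiff.log
      (ContDiff.div (by fun_prop) (by fun_prop) hD) fun σ => div_ne_zero (hN σ) (hD σ)))
  · exact (hmono.mono interior_subset).convexOn_of_deriv (convex_Ici 0)
      (fun σ _ => (h1 σ).continuousAt.continuousWithinAt)
      (fun σ _ => (h1 σ).differentiableAt.differentiableWithinAt)
end

section
/- Let 1 < γ < 2 and define f : ℝ → ℝ by f(σ) = (1−γ)σ + (γ/2)·ln( (1 + (γ−1)e^σ) / (1 + (γ−1)e^{−σ}) ). Then f is superadditive on nonnegative arguments: for all ω₁, ω₂ ≥ 0, f(ω₁ + ω₂) ≥ f(ω₁) + f(ω₂). -/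
/-- Multiplicative form of the superadditivity, in the variables `X = exp ω₁`, `Y = exp ω₂`. -/
lemma shock_ratio_mul_le {a X Y : ℝ} (ha0 : 0 < a) (ha1 : a < 1) (hX : 1 ≤ X) (hY : 1 ≤ Y) :
    (1 + a * X) / (1 + a * X⁻¹) * ((1 + a * Y) / (1 + a * Y⁻¹)) ≤
      (1 + a * (X * Y)) / (1 + a * (X * Y)⁻¹) := by
  have ratio_eq : ∀ Z : ℝ, 1 ≤ Z → (1 + a * Z) / (1 + a * Z⁻¹) = Z * (1 + a * Z) / (Z + a) := by
    intro Z hZ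
    have hZ0 : 0 < Z := by linarith
    field_simp
  have hXY : 1 ≤ X * Y := one_le_mul_of_one_le_of_one_le hX hY
  rw [ratio_eq X hX, ratio_eq Y hY, ratio_eq _ hXY, div_mul_div_comm,
    div_le_div_iff₀ (by positivity) (by positivity)]
  have key : 0 ≤ X * Y * (a * (1 - a) * ((X * Y - 1) * ((X - 1) * (Y - 1)))) := by
    have h1 := sub_nonneg.2 ha1.le
    have h2 := sub_nonneg.2 hX
    have h3 := sub_nonneg.2 hY
    have h4 := sub_nonneg.2 hXY
    positivity
  linear_combination key

/-- The entropy-jump function `f` is superadditive on nonnegative arguments: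
`f(ω₁ + ω₂) ≥ f(ω₁) + f(ω₂)` for `ω₁, ω₂ ≥ 0`. -/
theorem entropy_jump_superadditive
    (γ : ℝ) (hγ1 : 1 < γ) (hγ2 : γ < 2)
    (f : ℝ → ℝ)
    (hf : f = fun σ => (1 - γ) * σ
      + (γ / 2) * Real.log ((1 + (γ - 1) * Real.exp σ) / (1 + (γ - 1) * Real.exp (-σ)))) :
    ∀ ω₁ ω₂ : ℝ, 0 ≤ ω₁ → 0 ≤ ω₂ → f ω₁ + f ω₂ ≤ f (ω₁ + ω₂) := by
  intro x y hx hy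
  have ha : 0 < γ - 1 := by linarith
  have hpos : ∀ σ : ℝ,
      0 < (1 + (γ - 1) * Real.exp σ) / (1 + (γ - 1) * Real.exp (-σ)) := fun σ => by positivity
  have hratio := shock_ratio_mul_le ha (by linarith) (Real.one_le_exp hx) (Real.one_le_exp hy)
  rw [← Real.exp_add, ← Real.exp_neg, ← Real.exp_neg, ← Real.exp_neg] at hratio
  have hlog := Real.log_le_log (mul_pos (hpos x) (hpos y)) hratio
  rw [Real.log_mul (hpos x).ne' (hpos y).ne'] at hlog
  have hscaled := mul_le_mul_of_nonneg_left hlog (by linarith : 0 ≤ γ / 2)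
  simp only [hf]
  linarith
end
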